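/- The special polynomials T_{m,n}(t), defined by the initial values T_{0,0} = T_{0,1} = 1, T_{1,0} = ∑_i θ_i t_i − κ_∞, T_{1,1} = ∏_i t_i · (κ_∞ − ∑_j θ_j t_j^{−1}), and the Toda-type recurrence relations T_{m+1,n} · T_{m−1,n} = ∏_i t_i · { D log T_{m,n} + κ_∞ ∑_i θ_i (t_i²+1)/t_i − (1/2) ∑_{i,j} θ_i θ_j (t_i²+t_j²)/(t_i t_j) − κ_∞² + (2m)² } · T_{m,n}² (with D = (∑_i ((t_i²−1)/t_i) ∂/∂t_i − 2)(∑_i t_i(t_i²−1) ∂/∂t_i)) and the analogous relation in n with (2n−1)² in place of (2m)², satisfy the symmetry T_{−m,n}(t) = T_{m,1−n}(t) = (−1)^{m(2n−1)} ∏_i t_i^{m²+n(n−1)} · T_{m,n}(t^{−1}). -/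

import Mathlib

open Finset MvPolynomial

noncomputable section

/-- A `K`-derivation of the rational function field is determined by its values on variables. -/
lemma der_ext_aux {K F : Type*} [Field K] {N : ℕ}
    [Field F] [Algebra (MvPolynomial (Fin N) K) F]
    [IsFractionRing (MvPolynomial (Fin N) K) F]
    [Algebra K F] [IsScalarTower K (MvPolynomial (Fin N) K) F]
    (D D' : Derivation K F F)
    (h : ∀ i, D (algebraMap (MvPolynomial (Fin N) K) F (X i)) =
      D' (algebraMap (MvPolynomial (Fin N) K) F (X i))) (f : F) : D f = D' f := by
  have hp : ∀ p : MvPolynomial (Fin N) K, D (algebraMap _ F p) = D' (algebraMap _ F p) := by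
    intro p
    induction p using MvPolynomial.induction_on with
    | C a =>
      have : algebraMap (MvPolynomial (Fin N) K) F (C a) = algebraMap K F a := by
        rw [IsScalarTower.algebraMap_apply K (MvPolynomial (Fin N) K) F]; rfl
      rw [this, D.map_algebraMap, D'.map_algebraMap]
    | add p q hp hq => simp only [map_add, hp, hq]
    | mul_X p i hp => simp only [map_mul, Derivation.leibniz, hp, h]
  obtain ⟨a, b, hb, rfl⟩ := IsFractionRing.div_surjective (A := MvPolynomial (Fin N) K) f
  simp only [Derivation.leibniz_div, hp]

lemma seq_unique_aux {F : Type*} [Field F] (g : ℤ → F → F) (a b : ℤ → F)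
    (ha : ∀ k, a k ≠ 0)
    (hga : ∀ k, a (k + 1) * a (k - 1) = g k (a k))
    (hgb : ∀ k, b (k + 1) * b (k - 1) = g k (b k))
    (h0 : a 0 = b 0) (h1 : a 1 = b 1) (k : ℤ) : a k = b k := by
  have key : ∀ k : ℤ, a k = b k ∧ a (k + 1) = b (k + 1) := by
    intro k
    induction k using Int.induction_on with
    | zero => exact ⟨h0, by simpa using h1⟩
    | succ i ih =>
      obtain ⟨h, h'⟩ := ih
      refine ⟨h', ?_⟩
      have e1 := hga (i + 1)
      have e2 := hgb (i + 1)
      rw [← h', ← e1] at e2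
      simp only [add_sub_cancel_right] at e2
      rw [← h] at e2
      exact (mul_right_cancel₀ (ha _) e2).symm
    | pred i ih =>
      obtain ⟨h, h'⟩ := ih
      refine ⟨?_, by simpa using h⟩
      have e1 := hga (-i)
      have e2 := hgb (-i)
      rw [← h, ← e1, ← h'] at e2
      exact (mul_left_cancel₀ (ha _) e2).symm
  exact (key k).1

lemma grid_unique_aux {F : Type*} [Field F] (g h : ℤ → F → F) (a b : ℤ → ℤ → F)
    (ha : ∀ k l, a k l ≠ 0)
    (hga : ∀ k l, a (k + 1) l * a (k - 1) l = g k (a k l))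
    (hgb : ∀ k l, b (k + 1) l * b (k - 1) l = g k (b k l))
    (hha : ∀ k l, a k (l + 1) * a k (l - 1) = h l (a k l))
    (hhb : ∀ k l, b k (l + 1) * b k (l - 1) = h l (b k l))
    (h00 : a 0 0 = b 0 0) (h01 : a 0 1 = b 0 1) (h10 : a 1 0 = b 1 0) (h11 : a 1 1 = b 1 1)
    (k l : ℤ) : a k l = b k l := by
  refine seq_unique_aux h (a k) (b k) (ha k) (hha k) (hhb k) ?_ ?_ l
  · exact seq_unique_aux g (a · 0) (b · 0) (ha · 0) (hga · 0) (hgb · 0) h00 h10 k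
  · exact seq_unique_aux g (a · 1) (b · 1) (ha · 1) (hga · 1) (hgb · 1) h01 h11 k

lemma der_prod_aux {K F ι : Type*} [Field K] [Field F] [Algebra K F] (D : Derivation K F F)
    (s : Finset ι) (t : ι → F) (ht : ∀ i, t i ≠ 0) :
    D (∏ i ∈ s, t i) = (∏ i ∈ s, t i) * ∑ i ∈ s, D (t i) / t i := by
  classical
  induction s using Finset.induction_on with
  | empty => simp
  | insert a s ha ih =>
    rw [Finset.prod_insert ha, Finset.sum_insert ha, D.leibniz, ih]
    have := ht a
    simp only [smul_eq_mul]
    field_simp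
    ring

/-- the special polynomials T_{m,n}(t), determined by the initial values
T₀₀ = T₀₁ = 1, T₁₀ = ∑θᵢtᵢ − κ_∞, T₁₁ = ∏tᵢ·(κ_∞ − ∑θⱼtⱼ⁻¹) and the Toda-type bilinear
recurrences, satisfy T_{−m,n}(t) = T_{m,1−n}(t) = (−1)^{m(2n−1)} ∏tᵢ^{m²+n(n−1)} T_{m,n}(t⁻¹).

Here `F` is the field ℚ(κ_∞,θ)(t₁,…,t_N) realized as the fraction field of K[t₁,…,t_N]
(with K a field containing the parameters), `d i` is the unique K-derivation ∂/∂tᵢ,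
and `σ` is the unique K-automorphism with σ(tᵢ) = tᵢ⁻¹ (substitution t ↦ t⁻¹).
`D log f` is expressed via the logarithmic-derivative rule as E1(E2 f / f) − 2·(E2 f / f),
where E2 = ∑ tᵢ(tᵢ²−1)∂/∂tᵢ and E1 = ∑ ((tᵢ²−1)/tᵢ)∂/∂tᵢ. -/
theorem stmt14 {K F : Type*} [Field K] [CharZero K] {N : ℕ}
    [Field F] [Algebra (MvPolynomial (Fin N) K) F]
    [IsFractionRing (MvPolynomial (Fin N) K) F]
    [Algebra K F] [IsScalarTower K (MvPolynomial (Fin N) K) F]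
    (κ' : F) (θ' : Fin N → F) (t : Fin N → F)
    (ht : ∀ i, t i = algebraMap (MvPolynomial (Fin N) K) F (X i))
    (hκ : ∃ c : K, κ' = algebraMap K F c)
    (hθ : ∀ i, ∃ c : K, θ' i = algebraMap K F c)
    (d : Fin N → Derivation K F F)
    (hd : ∀ i j : Fin N, d i (t j) = if i = j then 1 else 0)
    (σ : F ≃ₐ[K] F) (hσ : ∀ i, σ (t i) = (t i)⁻¹)
    (E1 E2 Dlog : F → F)
    (hE1 : ∀ f, E1 f = ∑ i, ((t i) ^ 2 - 1) / t i * d i f)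
    (hE2 : ∀ f, E2 f = ∑ i, t i * ((t i) ^ 2 - 1) * d i f)
    (hDlog : ∀ f, Dlog f = E1 (E2 f / f) - 2 * (E2 f / f))
    (T : ℤ → ℤ → F) (hT0 : ∀ m n, T m n ≠ 0)
    (h00 : T 0 0 = 1) (h01 : T 0 1 = 1)
    (h10 : T 1 0 = (∑ i, θ' i * t i) - κ')
    (h11 : T 1 1 = (∏ i, t i) * (κ' - ∑ j, θ' j * (t j)⁻¹))
    (hrecM : ∀ m n : ℤ, T (m + 1) n * T (m - 1) n =
      (∏ i, t i) *
        (Dlog (T m n) + κ' * ∑ i, θ' i * ((t i) ^ 2 + 1) / t i -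
          (1 / 2) * ∑ i, ∑ j, θ' i * θ' j * ((t i) ^ 2 + (t j) ^ 2) / (t i * t j) -
          κ' ^ 2 + ((2 * m : ℤ) : F) ^ 2) * T m n ^ 2)
    (hrecN : ∀ m n : ℤ, T m (n + 1) * T m (n - 1) =
      (∏ i, t i) *
        (Dlog (T m n) + κ' * ∑ i, θ' i * ((t i) ^ 2 + 1) / t i -
          (1 / 2) * ∑ i, ∑ j, θ' i * θ' j * ((t i) ^ 2 + (t j) ^ 2) / (t i * t j) -
          κ' ^ 2 + ((2 * n - 1 : ℤ) : F) ^ 2) * T m n ^ 2)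
    (m n : ℤ) :
    T (-m) n = T m (1 - n) ∧
      T m (1 - n) =
        (-1 : F) ^ (m * (2 * n - 1)) * (∏ i, t i ^ (m ^ 2 + n * (n - 1))) * σ (T m n) := by
  classical
  have hchar : CharZero F := charZero_of_injective_algebraMap (algebraMap K F).injective
  have ht0 : ∀ i, t i ≠ 0 := by
    intro i
    rw [ht]
    intro h
    exact X_ne_zero i
      ((IsFractionRing.injective (MvPolynomial (Fin N) K) F) (by rw [h, map_zero]))
  -- bundled derivations
  let A1 : Derivation K F F := ∑ i, (((t i) ^ 2 - 1) / t i) • d i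
  let A2 : Derivation K F F := ∑ i, (t i * ((t i) ^ 2 - 1)) • d i
  have happ : ∀ (c : Fin N → F) (f : F), (∑ i, c i • d i : Derivation K F F) f
      = ∑ i, c i * d i f := by
    intro c f
    rw [← Derivation.coeFnAddMonoidHom_apply, map_sum, Finset.sum_apply]
    rfl
  have hA1 : ∀ f, E1 f = A1 f := fun f => by rw [hE1, happ]
  have hA2 : ∀ f, E2 f = A2 f := fun f => by rw [hE2, happ]
  have hA1t : ∀ j, A1 (t j) = ((t j) ^ 2 - 1) / t j := fun j => by
    rw [happ]; simp [hd]
  have hA2t : ∀ j, A2 (t j) = t j * ((t j) ^ 2 - 1) := fun j => by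
    rw [happ]; simp [hd]
  clear_value A1 A2
  have hDl : ∀ f, Dlog f = A1 (A2 f / f) - 2 * (A2 f / f) := fun f => by
    rw [hDlog, hA1, hA2]
  -- commutator
  have hcomm : ∀ f, A1 (A2 f) - A2 (A1 f) = 2 * (A2 f - A1 f) := by
    intro f
    have := der_ext_aux (N := N) ⁅A1, A2⁆ ((2 : F) • (A2 - A1)) (fun j => by
      rw [← ht]
      have h0 := ht0 j
      simp only [Derivation.commutator_apply, Derivation.smul_apply, Derivation.sub_apply,
        hA1t, hA2t, Derivation.leibniz, Derivation.leibniz_div, map_sub, Derivation.leibniz_pow,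
        Derivation.map_one_eq_zero, smul_eq_mul, nsmul_eq_mul]
      field_simp
      push_cast
      ring) f
    simpa [Derivation.commutator_apply] using this
  -- conjugation by σ
  have hconj2 : ∀ f, A2 (σ f) = σ (A1 f) := by
    let B : Derivation K F F := Derivation.mk'
      (σ.symm.toLinearMap ∘ₗ A2.toLinearMap ∘ₗ σ.toLinearMap) (fun a b => by simp)
    have hB : ∀ f, B f = σ.symm (A2 (σ f)) := fun f => rfl
    intro f
    have := der_ext_aux (N := N) B A1 (fun j => by
      rw [← ht, hB, AlgEquiv.symm_apply_eq, hσ, Derivation.leibniz_inv, hA2t, hA1t]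
      have h0 := ht0 j
      simp only [map_div₀, map_sub, map_pow, map_one, hσ, smul_eq_mul]
      field_simp
      ring) f
    rw [hB, AlgEquiv.symm_apply_eq] at this
    exact this
  have hinv : ∀ i, σ ((t i)⁻¹) = t i := fun i => by rw [map_inv₀, hσ, inv_inv]
  have hconj1 : ∀ f, A1 (σ f) = σ (A2 f) := by
    let B : Derivation K F F := Derivation.mk'
      (σ.symm.toLinearMap ∘ₗ A1.toLinearMap ∘ₗ σ.toLinearMap) (fun a b => by simp)
    have hB : ∀ f, B f = σ.symm (A1 (σ f)) := fun f => rfl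
    intro f
    have := der_ext_aux (N := N) B A2 (fun j => by
      rw [← ht, hB, AlgEquiv.symm_apply_eq, hσ, Derivation.leibniz_inv, hA2t, hA1t]
      have h0 := ht0 j
      simp only [map_mul, map_sub, map_pow, map_one, hσ, smul_eq_mul]
      field_simp
      ring) f
    rw [hB, AlgEquiv.symm_apply_eq] at this
    exact this
  -- Dlog commutes with σ
  have hswap : ∀ f, f ≠ 0 → A2 (A1 f / f) - 2 * (A1 f / f) = Dlog f := by
    intro f hf
    have := hcomm f
    rw [hDl, Derivation.leibniz_div, Derivation.leibniz_div]
    simp only [smul_eq_mul]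
    field_simp
    linear_combination (-f) * this
  set P : F := ∏ i, t i with hP
  have hP0 : P ≠ 0 := Finset.prod_ne_zero_iff.mpr fun i _ => ht0 i
  have hσP : σ P = P⁻¹ := by
    rw [hP, map_prod, ← Finset.prod_inv_distrib]
    exact Finset.prod_congr rfl fun i _ => hσ i
  have hA2P : A2 P = P * ∑ i, ((t i) ^ 2 - 1) := by
    rw [hP, der_prod_aux A2 _ t ht0]
    congr 1
    refine Finset.sum_congr rfl fun i _ => ?_
    rw [hA2t]
    have := ht0 i
    field_simp
  have hA1s : A1 (∑ i, ((t i) ^ 2 - 1)) = 2 * ∑ i, ((t i) ^ 2 - 1) := by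
    rw [map_sum, Finset.mul_sum]
    refine Finset.sum_congr rfl fun i _ => ?_
    have := ht0 i
    simp only [map_sub, Derivation.leibniz_pow, Derivation.map_one_eq_zero, hA1t, smul_eq_mul,
      nsmul_eq_mul]
    push_cast
    field_simp
    ring
  have hDR : ∀ (a k : ℤ) (f : F), f ≠ 0 →
      Dlog ((-1 : F) ^ a * P ^ k * σ f) = σ (Dlog f) := by
    intro a k f hf
    have hσf : σ f ≠ 0 := by simpa using hf
    have hPk : P ^ k ≠ 0 := zpow_ne_zero _ hP0
    have hs : (-1 : F) ^ a ≠ 0 := zpow_ne_zero _ (by simp)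
    have hL : A2 ((-1 : F) ^ a * P ^ k * σ f) / ((-1 : F) ^ a * P ^ k * σ f)
        = (k : F) * ∑ i, ((t i) ^ 2 - 1) + σ (A1 f / f) := by
      have e1 : A2 ((-1 : F) ^ a) = 0 := by
        rw [Derivation.leibniz_zpow]; simp
      have e2 : A2 (P ^ k) = P ^ k * ((k : F) * ∑ i, ((t i) ^ 2 - 1)) := by
        rw [Derivation.leibniz_zpow, hA2P, zpow_sub_one₀ hP0]
        simp only [smul_eq_mul, zsmul_eq_mul]
        field_simp
      rw [Derivation.leibniz, Derivation.leibniz, e1, e2, hconj2, map_div₀]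
      simp only [smul_eq_mul]
      field_simp
      ring
    rw [hDl, hL, map_add, hconj1, Derivation.leibniz, hA1s, Derivation.map_intCast,
      ← hswap f hf, map_sub, map_mul σ 2, map_ofNat]
    simp only [smul_eq_mul]
    ring
  -- the potential
  obtain ⟨κ, hκ⟩ := hκ
  have hσκ : σ κ' = κ' := by rw [hκ, AlgEquiv.commutes]
  have hσθ : ∀ i, σ (θ' i) = θ' i := fun i => by
    obtain ⟨c, hc⟩ := hθ i
    rw [hc, AlgEquiv.commutes]
  set a : F := ∑ i, θ' i * t i with ha
  set b : F := ∑ i, θ' i * (t i)⁻¹ with hb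
  have hσa : σ a = b := by
    rw [ha, hb, map_sum]
    exact Finset.sum_congr rfl fun i _ => by rw [map_mul, hσθ, hσ]
  have hσb : σ b = a := by
    rw [ha, hb, map_sum]
    exact Finset.sum_congr rfl fun i _ => by rw [map_mul, hσθ, hinv]
  have hU1 : ∑ i, θ' i * ((t i) ^ 2 + 1) / t i = a + b := by
    rw [ha, hb, ← Finset.sum_add_distrib]
    refine Finset.sum_congr rfl fun i _ => ?_
    have := ht0 i
    field_simp
  have hU2 : ∑ i, ∑ j, θ' i * θ' j * ((t i) ^ 2 + (t j) ^ 2) / (t i * t j) = 2 * (a * b) := by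
    have e : ∀ i j, θ' i * θ' j * ((t i) ^ 2 + (t j) ^ 2) / (t i * t j)
        = (θ' i * t i) * (θ' j * (t j)⁻¹) + (θ' i * (t i)⁻¹) * (θ' j * t j) := by
      intro i j
      have := ht0 i
      have := ht0 j
      field_simp
    simp only [e, Finset.sum_add_distrib, ← Finset.mul_sum, ← Finset.sum_mul, ← ha, ← hb]
    ring
  rw [hU1, hU2] at hrecM hrecN
  let g : ℤ → F → F := fun k x => P * (Dlog x + (κ' - b) * (a - κ') + (k : F) ^ 2) * x ^ 2
  have hgM : ∀ m n : ℤ, T (m + 1) n * T (m - 1) n = g (2 * m) (T m n) := by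
    intro m n
    rw [hrecM]
    simp only [g]
    ring
  have hgN : ∀ m n : ℤ, T m (n + 1) * T m (n - 1) = g (2 * n - 1) (T m n) := by
    intro m n
    rw [hrecN]
    simp only [g]
    ring
  have hgneg : ∀ (k l : ℤ) (x : F), k = -l → g k x = g l x := by
    rintro k l x rfl
    simp only [g]
    push_cast
    ring
  have hgR : ∀ (u k l : ℤ) (f : F), f ≠ 0 →
      g l ((-1 : F) ^ u * P ^ k * σ f) = P ^ (2 * k + 2) * σ (g l f) := by
    intro u k l f hf
    have hs : ((-1 : F) ^ u) ^ 2 = 1 := by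
      rw [← zpow_natCast, ← zpow_mul, mul_comm, zpow_mul]; simp
    simp only [g, hDR u k f hf, map_mul, map_add, map_sub, map_pow, hσP, hσa, hσb, hσκ,
      map_intCast, mul_pow, hs]
    rw [zpow_add₀ hP0, mul_comm 2 k, zpow_mul]
    have : P ^ (2 : ℤ) = P ^ 2 := by norm_cast
    have h3 : (P ^ k) ^ (2 : ℤ) = (P ^ k) ^ 2 := by norm_cast
    rw [this, h3]
    field_simp
    ring
  have hRR : ∀ (u v w k l r : ℤ) (x y : F), Even (u + v) → k + l = r →
      ((-1 : F) ^ u * P ^ k * σ x) * ((-1 : F) ^ v * P ^ l * σ y) = P ^ r * σ (x * y) := by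
    rintro u v w k l r x y he rfl
    have hs : (-1 : F) ^ u * (-1 : F) ^ v = 1 := by
      rw [← zpow_add₀ (by simp), he.neg_one_zpow]
    rw [zpow_add₀ hP0, map_mul]
    linear_combination (P ^ k * P ^ l * σ x * σ y) * hs
  -- initial values
  have hD1 : Dlog 1 = 0 := by rw [hDl]; simp
  have hm10 : T (-1) 0 = T 1 1 := by
    have := hgM 0 0
    simp only [g, h00, hD1] at this
    apply mul_left_cancel₀ (hT0 1 0)
    norm_num at this
    rw [this, h10, h11]
    ring
  have hm11 : T (-1) 1 = T 1 0 := by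
    have := hgM 0 1
    simp only [g, h01, hD1] at this
    apply mul_left_cancel₀ (hT0 1 1)
    norm_num at this
    rw [this, h10, h11]
    ring
  -- recurrences for n ↦ 1 - n
  have hM' : ∀ m n : ℤ, T (m + 1) (1 - n) * T (m - 1) (1 - n) = g (2 * m) (T m (1 - n)) :=
    fun m n => hgM m (1 - n)
  have hN' : ∀ m n : ℤ, T m (1 - (n + 1)) * T m (1 - (n - 1)) = g (2 * n - 1) (T m (1 - n)) := by
    intro m n
    rw [← hgneg (2 * (1 - n) - 1) (2 * n - 1) _ (by ring), ← hgN, mul_comm]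
    congr 2 <;> ring
  constructor
  · refine (grid_unique_aux (fun k => g (2 * k)) (fun k => g (2 * k - 1))
      (fun m n => T m (1 - n)) (fun m n => T (-m) n) (fun _ _ => hT0 _ _) hM' ?_ hN'
      (fun m n => hgN (-m) n) ?_ ?_ ?_ ?_ m n).symm
    · intro m n
      show T (-(m + 1)) n * T (-(m - 1)) n = g (2 * m) (T (-m) n)
      rw [← hgneg (2 * (-m)) (2 * m) _ (by ring), ← hgM, mul_comm]
      congr 2 <;> ring
    · simp [h00, h01]
    · simp [h00, h01]
    · simp [hm10]
    · simp [hm11]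
  · rw [Finset.prod_zpow]
    refine (grid_unique_aux (fun k => g (2 * k)) (fun k => g (2 * k - 1))
      (fun m n => T m (1 - n))
      (fun m n => (-1 : F) ^ (m * (2 * n - 1)) * P ^ (m ^ 2 + n * (n - 1)) * σ (T m n))
      (fun _ _ => hT0 _ _) hM' ?_ hN' ?_ ?_ ?_ ?_ ?_ m n)
    · intro m n
      rw [hgR _ _ _ _ (hT0 m n), ← hgM]
      exact hRR _ _ 0 _ _ _ _ _ ⟨m * (2 * n - 1), by ring⟩ (by ring)
    · intro m n
      rw [hgR _ _ _ _ (hT0 m n), ← hgN]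
      exact hRR _ _ 0 _ _ _ _ _ ⟨m * (2 * n - 1), by ring⟩ (by ring)
    · simp [h00, h01]
    · simp [h00, h01]
    · simp [h10, h11, hσa, hσκ]
      ring
    · simp [h10, h11, hσb, hσκ, hσP]
      field_simp
      ring
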